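/- Let G be a countably infinite discrete group. Then there exists ξ ∈ βG ∖ G such that the orbit {ξg : g ∈ G} under the extended right action is a discrete subset of βG; in particular, ξ does not belong to the closure of {ξg : g ∈ G, g ≠ e}. -/

import Mathlib

open Metric Set

noncomputable section

/-- The continuous extension to `βG` of right translation by `g` on a discrete group `G`:
`ξ ↦ ξg`. -/
def rightTrans {G : Type} [Group G] [TopologicalSpace G] [DiscreteTopology G] (g : G) :
    StoneCech G → StoneCech G :=
  stoneCechExtend (continuous_of_discreteTopology
    (f := fun x : G => stoneCechUnit (x * g)))

open Filter Topology

/-- An infinite countable group contains an injective sequence whose range meets each of its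
nontrivial right translates in a finite set. -/
theorem exists_injective_seq_finite_mul_mem_range (G : Type*) [Group G] [Countable G]
    [Infinite G] : ∃ f : ℕ → G, Function.Injective f ∧
      ∀ g : G, g ≠ 1 → {n | f n * g ∈ Set.range f}.Finite := by
  obtain ⟨φ, hφ⟩ := exists_injective_nat G
  have hlt (a : ℕ) : {x : G | φ x < a}.Finite := (Set.finite_Iio a).preimage hφ.injOn
  have hle (a : ℕ) : {x : G | φ x ≤ a}.Finite := (Set.finite_Iic a).preimage hφ.injOn
  obtain ⟨f, -, hf⟩ := exists_seq_of_forall_finset_exists (fun _ : G => True)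
    (fun x y => x ≠ y ∧ φ x < φ (x⁻¹ * y) ∧ φ x < φ (y⁻¹ * x)) (by
      intro s _
      have hfin : (⋃ x ∈ s, ({x} ∪ (fun y => x⁻¹ * y) ⁻¹' {z | φ z ≤ φ x} ∪
          (fun y => y⁻¹ * x) ⁻¹' {z | φ z ≤ φ x})).Finite :=
        s.finite_toSet.biUnion fun x _ =>
          ((Set.finite_singleton x).union
            ((hle _).preimage (mul_right_injective x⁻¹).injOn)).union
            ((hle _).preimage ((mul_left_injective x).comp inv_injective).injOn)
      obtain ⟨y, hy⟩ := hfin.exists_notMem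
      refine ⟨y, trivial, fun x hx => ?_⟩
      simp only [Set.mem_iUnion, not_exists] at hy
      have := hy x hx
      simp only [Set.mem_union, Set.mem_singleton_iff, Set.mem_preimage, Set.mem_ofPred_eq,
        not_or, not_le] at this
      exact ⟨Ne.symm this.1.1, this.1.2, this.2⟩)
  have hinj : Function.Injective f := by
    intro m n h
    rcases lt_trichotomy m n with hmn | hmn | hmn
    · exact absurd h (hf m n hmn).1
    · exact hmn
    · exact absurd h.symm (hf n m hmn).1
  refine ⟨f, hinj, fun g hg => ?_⟩
  refine (((hlt (φ g)).union
    ((hlt (φ g)).preimage (mul_left_injective g).injOn)).preimage hinj.injOn).subset ?_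
  rintro n ⟨m, hm⟩
  have hgm : (f n)⁻¹ * f m = g := by rw [hm, inv_mul_cancel_left]
  rcases lt_trichotomy n m with h | rfl | h
  · left
    simpa [hgm] using (hf n m h).2.1
  · simp [← hgm] at hg
  · right
    simpa [← hm, hgm] using (hf m n h).2.2

section RightTrans

variable {G : Type} [Group G] [TopologicalSpace G] [DiscreteTopology G]

theorem continuous_rightTrans (g : G) : Continuous (rightTrans g) :=
  continuous_stoneCechExtend _

@[simp]
theorem rightTrans_stoneCechUnit (g x : G) :
    rightTrans g (stoneCechUnit x) = stoneCechUnit (x * g) :=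
  stoneCechExtend_stoneCechUnit _ x

theorem rightTrans_rightTrans (g h : G) (ξ : StoneCech G) :
    rightTrans h (rightTrans g ξ) = rightTrans (g * h) ξ := by
  refine congr_fun (stoneCech_hom_ext (g₁ := rightTrans h ∘ rightTrans g)
    ((continuous_rightTrans h).comp (continuous_rightTrans g)) (continuous_rightTrans (g * h))
    ?_) ξ
  ext x
  simp [mul_assoc]

@[simp]
theorem rightTrans_one (ξ : StoneCech G) : rightTrans (1 : G) ξ = ξ := by
  refine congr_fun (stoneCech_hom_ext (g₁ := rightTrans (1 : G)) (g₂ := id)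
    (continuous_rightTrans 1) continuous_id ?_) ξ
  ext x
  simp

/-- If an open set contains `ξ` but no `ξg` with `g ≠ 1`, then the orbit of `ξ` is discrete. -/
theorem discreteTopology_range_rightTrans {ξ : StoneCech G} {U : Set (StoneCech G)}
    (hU : IsOpen U) (hξ : ξ ∈ U) (h : ∀ g : G, g ≠ 1 → rightTrans g ξ ∉ U) :
    DiscreteTopology ↥(Set.range fun g : G => rightTrans g ξ) := by
  rw [discreteTopology_iff_isOpen_singleton]
  rintro ⟨_, g, rfl⟩
  refine ⟨rightTrans g⁻¹ ⁻¹' U, hU.preimage (continuous_rightTrans _), ?_⟩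
  ext ⟨_, k, rfl⟩
  simp only [Set.mem_preimage, Set.mem_singleton_iff, Subtype.ext_iff, rightTrans_rightTrans]
  constructor
  · intro hk
    by_contra hne
    refine h (k * g⁻¹) (fun hkg => hne ?_) hk
    rw [mul_inv_eq_one.mp hkg]
  · intro hk
    rw [← rightTrans_rightTrans, hk, rightTrans_rightTrans, mul_inv_cancel, rightTrans_one]
    exact hξ

end RightTrans

/-- Every subset of a discrete space is the trace of a clopen subset of its Stone–Čech
compactification. -/
theorem exists_isClopen_stoneCechUnit_mem_iff {X : Type*} [TopologicalSpace X]
    [DiscreteTopology X] (s : Set X) :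
    ∃ U : Set (StoneCech X), IsClopen U ∧ ∀ x, stoneCechUnit x ∈ U ↔ x ∈ s := by
  classical
  have hc : Continuous fun x : X => decide (x ∈ s) := continuous_of_discreteTopology
  exact ⟨stoneCechExtend hc ⁻¹' {true},
    (isClopen_discrete {true}).preimage (continuous_stoneCechExtend hc), fun x => by simp⟩

/-- **Existence of discrete orbits in `βG`** (Proposition 5.5 of the paper).
For every countably infinite discrete group `G` there is a point `ξ ∈ βG ∖ G` whose orbit
`{ξg : g ∈ G}` under the extended right action is a discrete subset of `βG`; in
particular `ξ` is not in the closure of `{ξg : g ≠ e}`. -/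
theorem exists_discrete_orbit_in_stoneCech
    (G : Type) [Group G] [TopologicalSpace G] [DiscreteTopology G]
    [Countable G] [Infinite G] :
    ∃ ξ : StoneCech G, ξ ∉ Set.range (stoneCechUnit : G → StoneCech G) ∧
      DiscreteTopology ↥(Set.range fun g : G => rightTrans g ξ) ∧
      ξ ∉ closure ((fun g : G => rightTrans g ξ) '' {g : G | g ≠ 1}) := by
  obtain ⟨f, hinj, hf⟩ := exists_injective_seq_finite_mul_mem_range G
  obtain ⟨ξ, -, hξ⟩ := isCompact_univ.ultrafilter_le_nhds
    ((hyperfilter ℕ).map fun n => (stoneCechUnit (f n) : StoneCech G)) (by simp)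
  have hlim : Tendsto (fun n => (stoneCechUnit (f n) : StoneCech G)) (hyperfilter ℕ) (𝓝 ξ) := hξ
  have notMem {V : Set (StoneCech G)} (hV : IsOpen V)
      (hfin : {n | stoneCechUnit (f n) ∈ V}.Finite) : ξ ∉ V := fun h =>
    hfin.notMem_hyperfilter (hlim (hV.mem_nhds h))
  obtain ⟨U, hU, hUf⟩ := exists_isClopen_stoneCechUnit_mem_iff (Set.range f)
  have hξU : ξ ∈ U := by
    by_contra h
    exact notMem hU.compl.isOpen (by simp [hUf]) h
  have hgU (g : G) (hg : g ≠ 1) : rightTrans g ξ ∉ U :=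
    notMem (hU.isOpen.preimage (continuous_rightTrans g)) (by
      simpa only [Set.mem_preimage, rightTrans_stoneCechUnit, hUf] using hf g hg)
  refine ⟨ξ, ?_, discreteTopology_range_rightTrans hU.isOpen hξU hgU, fun hcl => ?_⟩
  · rintro ⟨a, rfl⟩
    obtain ⟨V, hV, hVa⟩ := exists_isClopen_stoneCechUnit_mem_iff ({a} : Set G)
    refine notMem hV.isOpen ?_ ((hVa a).mpr rfl)
    simpa only [hVa, Set.preimage] using (Set.finite_singleton a).preimage hinj.injOn
  · obtain ⟨_, hηU, g, hg, rfl⟩ := mem_closure_iff.mp hcl U hU.isOpen hξU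
    exact hgU g hg hηU

end
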